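/- Over the complex numbers, the vector g + i·k is an eigenvector of S with eigenvalue σ' = −1 + ω·2^(1/3), where ω = e^(2πi/3): S·(g + i·k) = σ'·(g + i·k). -/

import Mathlib

noncomputable def cbrt2 : ℝ := (2 : ℝ) ^ ((1 : ℝ) / 3)
noncomputable def cbrt4 : ℝ := (2 : ℝ) ^ ((2 : ℝ) / 3)
noncomputable def ω : ℂ := Complex.exp (2 * Real.pi * Complex.I / 3)

def S : Matrix (Fin 3) (Fin 3) ℂ := !![0, 0, 1; 1, 0, -3; 0, 1, -3]

noncomputable def g : Fin 3 → ℝ :=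
  (1 / 12 : ℝ) • ![-cbrt2, 4 + 2 * cbrt2 - cbrt4, cbrt2 - cbrt4]

noncomputable def k : Fin 3 → ℝ :=
  (Real.sqrt 3 / 12) • ![cbrt2, -2 * cbrt2 - cbrt4, -cbrt2 - cbrt4]

/-- `g` and `k` regarded as complex vectors. -/
noncomputable def gc : Fin 3 → ℂ := fun i => (g i : ℂ)
noncomputable def kc : Fin 3 → ℂ := fun i => (k i : ℂ)

theorem cbrt4_eq_cbrt2_sq : cbrt4 = cbrt2 ^ 2 := by
  rw [cbrt2, cbrt4, ← Real.rpow_natCast, ← Real.rpow_mul (by norm_num)]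
  norm_num

theorem cbrt2_pow_three : cbrt2 ^ 3 = 2 := by
  rw [cbrt2, ← Real.rpow_natCast, ← Real.rpow_mul (by norm_num)]
  norm_num

theorem ω_pow_three : ω ^ 3 = 1 := by
  rw [ω, ← Complex.exp_nat_mul, ← Complex.exp_two_pi_mul_I]
  congr 1
  push_cast
  ring

theorem ω_eq : ω = (-1 + Complex.I * (Real.sqrt 3 : ℂ)) / 2 := by
  have h : (2 * Real.pi * Complex.I / 3 : ℂ) = ((Real.pi - Real.pi / 3 : ℝ) : ℂ) * Complex.I := by
    push_cast
    ring
  rw [ω, h, Complex.exp_mul_I, ← Complex.ofReal_cos, ← Complex.ofReal_sin, Real.cos_pi_sub,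
    Real.sin_pi_sub, Real.cos_pi_div_three, Real.sin_pi_div_three]
  push_cast
  ring

theorem I_mul_sqrt_three : Complex.I * (Real.sqrt 3 : ℂ) = 2 * ω + 1 := by
  rw [ω_eq]
  ring

theorem ω_sq : ω ^ 2 = -1 - ω := by
  have h3 : (Real.sqrt 3 : ℂ) ^ 2 = 3 := by
    exact_mod_cast Real.sq_sqrt (show (0 : ℝ) ≤ 3 by norm_num)
  rw [ω_eq]
  linear_combination (Real.sqrt 3 : ℂ) ^ 2 / 4 * Complex.I_sq - h3 / 4

/-- The vector `g + i k` is a polynomial expression in `ω * cbrt2`. -/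
theorem gc_add_I_smul_kc :
    gc + Complex.I • kc = (1 / 6 : ℂ) • ![ω * cbrt2, 2 - 2 * (ω * cbrt2) + (ω * cbrt2) ^ 2,
      (ω * cbrt2) ^ 2 - ω * cbrt2] := by
  ext i
  fin_cases i <;> simp [gc, kc, g, k, cbrt4_eq_cbrt2_sq]
  · linear_combination (cbrt2 : ℂ) / 12 * I_mul_sqrt_three
  · linear_combination (-2 * cbrt2 - cbrt2 ^ 2 : ℂ) / 12 * I_mul_sqrt_three
      - (cbrt2 : ℂ) ^ 2 / 6 * ω_sq
  · linear_combination (-cbrt2 - cbrt2 ^ 2 : ℂ) / 12 * I_mul_sqrt_three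
      - (cbrt2 : ℂ) ^ 2 / 6 * ω_sq

theorem g_plus_ik_is_eigenvector :
    S.mulVec (gc + Complex.I • kc) =
      (-1 + ω * (cbrt2 : ℂ)) • (gc + Complex.I • kc) := by
  have ht : (ω * cbrt2) ^ 3 = 2 := by
    rw [mul_pow, ω_pow_three, one_mul]
    exact_mod_cast cbrt2_pow_three
  rw [gc_add_I_smul_kc]
  generalize ω * (cbrt2 : ℂ) = t at ht ⊢
  ext i
  fin_cases i <;> simp [S, Matrix.mulVec, dotProduct, Fin.sum_univ_three]
  · ring
  · linear_combination -ht / 6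
  · linear_combination -ht / 6
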